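/- There exists an absolute constant c > 0 such that for every n ∈ ℕ, every convex symmetric body V ⊂ ℝⁿ with V ⊆ B₂ⁿ, and every linear subspace L ⊆ ℝⁿ of dimension m (1 ≤ m ≤ n), there exists a nonzero vector α* ∈ L such that ‖α*‖₂ ≥ (2c / M_V)^{n/m} · ω_{n,m} · ‖α*‖_V, where ω_{n,m} = (Γ(n/2 + 1) / (Γ((n−m)/2 + 1) · Γ(m/2 + 1)))^{1/m} and M_V is the Lévy mean of the gauge of V. -/

import Mathlib

open MeasureTheory Metric Set

/-- A convex symmetric body in `ℝⁿ`: a compact convex set with `0` in its interior,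
satisfying `V = -V`. -/
def IsSymmBody (n : ℕ) (V : Set (EuclideanSpace ℝ (Fin n))) : Prop :=
  IsCompact V ∧ Convex ℝ V ∧ (0 : EuclideanSpace ℝ (Fin n)) ∈ interior V ∧ V = -V

/-- The Lévy mean of a function on `ℝⁿ`: its average over the unit Euclidean sphere
with respect to the rotation-invariant probability measure (the normalization of the
spherical measure `volume.toSphere`). -/
noncomputable def levyMean (n : ℕ) (f : EuclideanSpace ℝ (Fin n) → ℝ) : ℝ :=
  ⨍ x : sphere (0 : EuclideanSpace ℝ (Fin n)) 1,
    f x ∂((volume : Measure (EuclideanSpace ℝ (Fin n))).toSphere)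

/-- `ω_{n,m} = (Γ(n/2 + 1) / (Γ((n−m)/2 + 1) · Γ(m/2 + 1)))^{1/m}`. -/
noncomputable def omegaNM (n m : ℕ) : ℝ :=
  (Real.Gamma ((n : ℝ) / 2 + 1) /
      (Real.Gamma (((n : ℝ) - (m : ℝ)) / 2 + 1) * Real.Gamma ((m : ℝ) / 2 + 1))) ^ (1 / (m : ℝ))

/-- The volume of the unit ball of a Euclidean space of dimension `d`. -/
noncomputable def unitBallVolume (d : ℕ) : ℝ := √Real.pi ^ d / Real.Gamma ((d : ℝ) / 2 + 1)

theorem unitBallVolume_pos (d : ℕ) : 0 < unitBallVolume d := by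
  unfold unitBallVolume
  have := Real.Gamma_pos_of_pos (show (0 : ℝ) < (d : ℝ) / 2 + 1 by positivity)
  have := Real.pi_pos
  positivity

section InnerProductSpace

variable {F : Type*} [NormedAddCommGroup F] [InnerProductSpace ℝ F] [FiniteDimensional ℝ F]
  [MeasurableSpace F] [BorelSpace F]

theorem volume_real_closedBall (x : F) {r : ℝ} (hr : 0 ≤ r) :
    volume.real (closedBall x r) =
      r ^ Module.finrank ℝ F * unitBallVolume (Module.finrank ℝ F) := by
  rcases subsingleton_or_nontrivial F with hF | hF
  · have hb : closedBall x r = {0} :=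
      (nonempty_closedBall.2 hr).eq_univ.trans (subsingleton_univ.eq_singleton_of_mem trivial)
    have hv : volume ({0} : Set F) = 1 := by
      have h := ((stdOrthonormalBasis ℝ F).volume_parallelepiped)
      rwa [(show (parallelepiped (stdOrthonormalBasis ℝ F) : Set F) = {0} from
        Set.Nonempty.eq_univ ⟨0, mem_parallelepiped_iff _ _ |>.2
          ⟨0, by simp, Subsingleton.elim _ _⟩⟩ |>.trans
          (subsingleton_univ.eq_singleton_of_mem trivial))] at h
    simp [measureReal_def, hb, hv, unitBallVolume, Module.finrank_zero_of_subsingleton]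
  · rw [measureReal_def, InnerProductSpace.volume_closedBall, ← unitBallVolume,
      ENNReal.toReal_mul, ENNReal.toReal_pow, ENNReal.toReal_ofReal hr,
      ENNReal.toReal_ofReal (unitBallVolume_pos _).le]

variable (L : Submodule ℝ F)

theorem Submodule.measurePreserving_add_orthogonal :
    MeasurePreserving (fun p : L × Lᗮ => (p.1 : F) + p.2) := by
  have h := L.orthogonalDecomposition.symm.measurePreserving.comp
    (WithLp.volume_preserving_toLp L Lᗮ)
  convert h using 1
  ext p
  simp

theorem unitBallVolume_mul_orthogonal_le :
    unitBallVolume (Module.finrank ℝ L) * unitBallVolume (Module.finrank ℝ Lᗮ) ≤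
      √2 ^ Module.finrank ℝ F * unitBallVolume (Module.finrank ℝ F) := by
  have h1 := volume_real_closedBall (0 : L) zero_le_one
  have h2 := volume_real_closedBall (0 : Lᗮ) zero_le_one
  have h3 := volume_real_closedBall (0 : F) (Real.sqrt_nonneg 2)
  rw [one_pow, one_mul] at h1 h2
  rw [← h1, ← h2, ← h3, ← measureReal_prod_prod, ← Measure.volume_eq_prod,
    ← L.measurePreserving_add_orthogonal.measureReal_preimage
      measurableSet_closedBall.nullMeasurableSet]
  refine measureReal_mono ?_ ?_
  · rintro ⟨a, b⟩ ⟨ha, hb⟩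
    simp only [mem_closedBall_zero_iff, mem_preimage] at ha hb ⊢
    apply Real.le_sqrt_of_sq_le
    have horth : inner ℝ (a : F) (b : F) = 0 := L.inner_right_of_mem_orthogonal a.2 b.2
    have := norm_add_sq_eq_norm_sq_add_norm_sq_of_inner_eq_zero (a : F) (b : F) horth
    simp only [Submodule.coe_norm] at ha hb
    nlinarith [norm_nonneg (a : F), norm_nonneg (b : F)]
  · rw [L.measurePreserving_add_orthogonal.measure_preimage
      measurableSet_closedBall.nullMeasurableSet]
    exact measure_closedBall_lt_top.ne

theorem volume_real_le_of_inter_submodule_subset {V : Set F} (hV : Convex ℝ V) (hc : IsClosed V)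
    (hs : V = -V) {r R : ℝ} (hR : 0 ≤ R) (hVR : V ⊆ closedBall 0 R) (hr : 0 ≤ r)
    (hVL : ∀ x ∈ V, x ∈ L → ‖x‖ ≤ r) :
    volume.real V ≤ ((2 * r) ^ Module.finrank ℝ L * unitBallVolume (Module.finrank ℝ L)) *
      (R ^ Module.finrank ℝ Lᗮ * unitBallVolume (Module.finrank ℝ Lᗮ)) := by
  rw [← volume_real_closedBall (0 : L) (by positivity : 0 ≤ 2 * r),
    ← volume_real_closedBall (0 : Lᗮ) hR, measureReal_def, measureReal_def, measureReal_def,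
    ← ENNReal.toReal_mul]
  refine ENNReal.toReal_mono (ENNReal.mul_ne_top measure_closedBall_lt_top.ne
    measure_closedBall_lt_top.ne) ?_
  have hmeas := L.measurePreserving_add_orthogonal.measurable hc.measurableSet
  rw [← L.measurePreserving_add_orthogonal.measure_preimage hc.measurableSet.nullMeasurableSet,
    Measure.volume_eq_prod, Measure.prod_apply_symm hmeas, ← setLIntegral_const]
  rw [← lintegral_indicator measurableSet_closedBall]
  refine lintegral_mono fun b => ?_
  rcases eq_empty_or_nonempty ((fun a : L => (a, b)) ⁻¹'
    ((fun p : L × Lᗮ => (p.1 : F) + p.2) ⁻¹' V)) with he | ⟨a₀, ha₀⟩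
  · simp [he]
  · simp only [mem_preimage] at ha₀
    have hb : b ∈ closedBall (0 : Lᗮ) R := by
      have h := mem_closedBall_zero_iff.1 (hVR ha₀)
      have horth : inner ℝ (a₀ : F) (b : F) = 0 := L.inner_right_of_mem_orthogonal a₀.2 b.2
      have := norm_add_sq_eq_norm_sq_add_norm_sq_of_inner_eq_zero (a₀ : F) (b : F) horth
      rw [mem_closedBall_zero_iff, Submodule.coe_norm]
      nlinarith [norm_nonneg (a₀ : F), norm_nonneg (b : F), norm_nonneg ((a₀ : F) + b)]
    rw [indicator_of_mem hb, Measure.addHaar_closedBall_center volume (0 : L),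
      ← Measure.addHaar_closedBall_center volume a₀]
    refine measure_mono fun a ha => ?_
    simp only [mem_preimage] at ha
    have hneg : -((a₀ : F) + b) ∈ V := by rw [hs]; simpa using ha₀
    have hmid := hV ha hneg (by norm_num : (0 : ℝ) ≤ 1 / 2) (by norm_num : (0 : ℝ) ≤ 1 / 2)
      (by norm_num)
    have heq : (1 / 2 : ℝ) • ((a : F) + b) + (1 / 2 : ℝ) • -((a₀ : F) + b) =
        (1 / 2 : ℝ) • ((a : F) - a₀) := by module
    rw [heq] at hmid
    have := hVL _ hmid (L.smul_mem _ (L.sub_mem a.2 a₀.2))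
    rw [norm_smul] at this
    rw [mem_closedBall, dist_eq_norm, Submodule.coe_norm, Submodule.coe_sub]
    norm_num at this
    linarith

end InnerProductSpace

theorem IsSymmBody.integrable_gauge {n : ℕ} {V : Set (EuclideanSpace ℝ (Fin n))}
    (hV : IsSymmBody n V) :
    Integrable (fun x : sphere (0 : EuclideanSpace ℝ (Fin n)) 1 => gauge V x)
      (volume : Measure (EuclideanSpace ℝ (Fin n))).toSphere :=
  ((continuous_gauge hV.2.1 (mem_interior_iff_mem_nhds.1 hV.2.2.1)).comp
    continuous_subtype_val).integrable_of_hasCompactSupport (.of_compactSpace _)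

theorem one_le_levyMean_gauge {n : ℕ} (hn : 1 ≤ n) {V : Set (EuclideanSpace ℝ (Fin n))}
    (hV : IsSymmBody n V) (hV1 : V ⊆ closedBall 0 1) : 1 ≤ levyMean n (gauge V) := by
  have : Nonempty (Fin n) := ⟨⟨0, hn⟩⟩
  have hnhds := mem_interior_iff_mem_nhds.1 hV.2.2.1
  have := NeZero.mk (Measure.toSphere_ne_zero (volume : Measure (EuclideanSpace ℝ (Fin n))))
  have hμ : 0 < (volume : Measure (EuclideanSpace ℝ (Fin n))).toSphere.real univ :=
    measureReal_univ_pos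
  have hle : ∀ x : sphere (0 : EuclideanSpace ℝ (Fin n)) 1, 1 ≤ gauge V x := fun x => by
    simpa using le_gauge_of_subset_closedBall (absorbent_nhds_zero hnhds) zero_le_one hV1
      (x := (x : EuclideanSpace ℝ (Fin n)))
  have hint := integral_mono (integrable_const (1 : ℝ)) hV.integrable_gauge hle
  rw [integral_const, smul_eq_mul, mul_one] at hint
  rw [levyMean, average_eq, smul_eq_mul, inv_mul_eq_div, one_le_div hμ]
  exact hint

open scoped Pointwise in
theorem unitBallVolume_le_volume_real {n : ℕ} (hn : 1 ≤ n) {V : Set (EuclideanSpace ℝ (Fin n))}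
    (hV : IsSymmBody n V) (hM : 0 < levyMean n (gauge V)) :
    unitBallVolume n ≤ (4 * levyMean n (gauge V)) ^ n * volume.real V := by
  have : Nonempty (Fin n) := ⟨⟨0, hn⟩⟩
  have hnhds := mem_interior_iff_mem_nhds.1 hV.2.2.1
  have habs := absorbent_nhds_zero (𝕜 := ℝ) hnhds
  set M := levyMean n (gauge V) with hMdef
  set μ := (volume : Measure (EuclideanSpace ℝ (Fin n))).toSphere with hμdef
  have : NeZero μ := ⟨Measure.toSphere_ne_zero _⟩
  have hμ : 0 < μ.real univ := measureReal_univ_pos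
  have hintegral : ∫ x : sphere (0 : EuclideanSpace ℝ (Fin n)) 1, gauge V x ∂μ =
      M * μ.real univ := by
    rw [hMdef, levyMean, average_eq, smul_eq_mul, ← hμdef]
    field_simp
  have hmarkov := mul_meas_ge_le_integral_of_nonneg (.of_forall fun x => gauge_nonneg _)
    hV.integrable_gauge (2 * M)
  rw [← hμdef, hintegral] at hmarkov
  set A := {x : sphere (0 : EuclideanSpace ℝ (Fin n)) 1 | gauge V x < 2 * M} with hA
  have hAmeas : MeasurableSet A :=
    (((continuous_gauge hV.2.1 hnhds).comp continuous_subtype_val).measurable measurableSet_Iio)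
  have hcompl : {x : sphere (0 : EuclideanSpace ℝ (Fin n)) 1 | 2 * M ≤ gauge V x} = Aᶜ := by
    ext x; simp [hA]
  rw [hcompl, measureReal_compl hAmeas] at hmarkov
  have hhalf : μ.real univ ≤ 2 * μ.real A := by
    by_contra! h
    nlinarith
  have huniv : μ.real univ = n * unitBallVolume n := by
    rw [hμdef, Measure.toSphere_real_apply_univ,
      ← Measure.addHaar_real_closedBall_eq_addHaar_real_ball, volume_real_closedBall _ zero_le_one]
    simp
  have hcone : μ.real A = n * volume.real (Ioo (0 : ℝ) 1 • ((↑) '' A :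
      Set (EuclideanSpace ℝ (Fin n)))) := by
    rw [hμdef, measureReal_def, Measure.toSphere_apply' _ hAmeas]
    simp [measureReal_def]
  have hsub : Ioo (0 : ℝ) 1 • ((↑) '' A : Set (EuclideanSpace ℝ (Fin n))) ⊆ (2 * M) • V := by
    rintro _ ⟨t, ht, _, ⟨x, hx, rfl⟩, rfl⟩
    rw [mem_smul_set_iff_inv_smul_mem₀ (by positivity)]
    apply setOfPred_gauge_lt_one_subset_self hV.2.1 (mem_of_mem_nhds hnhds) habs
    simp only [mem_ofPred_eq]
    rw [gauge_smul_of_nonneg (by positivity), gauge_smul_of_nonneg ht.1.le, smul_eq_mul,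
      smul_eq_mul, inv_mul_lt_one₀ (by positivity)]
    exact (mul_le_of_le_one_left (gauge_nonneg _) ht.2.le).trans_lt hx
  have hvol : volume.real ((2 * M) • V) = (2 * M) ^ n * volume.real V := by
    rw [measureReal_def, Measure.addHaar_smul]
    simp [measureReal_def, abs_of_pos hM, pow_nonneg (mul_nonneg zero_le_two hM.le) n]
  have hle := measureReal_mono (μ := volume) hsub (hV.1.smul (2 * M)).measure_lt_top.ne
  rw [hvol] at hle
  rw [huniv, hcone] at hhalf
  have hn' : (0 : ℝ) < n := by exact_mod_cast hn
  have h1 : unitBallVolume n ≤ 2 * ((2 * M) ^ n * volume.real V) := by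
    refine le_of_mul_le_mul_left ?_ hn'
    nlinarith
  refine h1.trans ?_
  have h2 : (2 : ℝ) ≤ 2 ^ n := by simpa using pow_le_pow_right₀ one_le_two hn
  rw [show 4 * M = 2 * (2 * M) by ring, mul_pow 2 (2 * M), mul_assoc]
  gcongr

theorem omegaNM_pow {n m : ℕ} (hm : 1 ≤ m) (hmn : m ≤ n) :
    omegaNM n m ^ m = unitBallVolume m * unitBallVolume (n - m) / unitBallVolume n := by
  have hcast : (n : ℝ) - m = ((n - m : ℕ) : ℝ) := by push_cast [hmn]; ring
  have hΓ : ∀ d : ℕ, 0 < Real.Gamma ((d : ℝ) / 2 + 1) := fun d =>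
    Real.Gamma_pos_of_pos (by positivity)
  have h1 := hΓ n
  have h2 := hΓ m
  have h3 := hΓ (n - m)
  have hπ : √Real.pi ^ n = √Real.pi ^ m * √Real.pi ^ (n - m) := by
    rw [← pow_add, Nat.add_sub_cancel' hmn]
  have hpos := Real.sqrt_pos.2 Real.pi_pos
  rw [omegaNM, one_div, hcast, Real.rpow_inv_natCast_pow (by positivity) (by omega)]
  simp only [unitBallVolume, hπ]
  field_simp

theorem omegaNM_nonneg {n m : ℕ} (hmn : m ≤ n) : 0 ≤ omegaNM n m := by
  have hcast : (n : ℝ) - m = ((n - m : ℕ) : ℝ) := by push_cast [hmn]; ring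
  rw [omegaNM, hcast]
  have hΓ : ∀ d : ℕ, 0 < Real.Gamma ((d : ℝ) / 2 + 1) := fun d =>
    Real.Gamma_pos_of_pos (by positivity)
  have h1 := hΓ n
  have h2 := hΓ m
  have h3 := hΓ (n - m)
  positivity

/-- There is an absolute constant `c > 0` such that for every convex symmetric body
`V ⊆ B₂ⁿ` and every `m`-dimensional subspace `L` (`1 ≤ m ≤ n`), there is a nonzero
`α* ∈ L` with `‖α*‖₂ ≥ (2c / M_V)^{n/m} · ω_{n,m} · ‖α*‖_V`. -/
theorem exists_large_euclidean_norm :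
    ∃ c : ℝ, 0 < c ∧
      ∀ (n m : ℕ), 1 ≤ m → m ≤ n →
        ∀ V : Set (EuclideanSpace ℝ (Fin n)), IsSymmBody n V →
          V ⊆ closedBall (0 : EuclideanSpace ℝ (Fin n)) 1 →
          ∀ L : Submodule ℝ (EuclideanSpace ℝ (Fin n)), Module.finrank ℝ L = m →
            ∃ α ∈ L, α ≠ 0 ∧
              (2 * c / levyMean n (gauge V)) ^ ((n : ℝ) / (m : ℝ)) * omegaNM n m * gauge V α ≤
                ‖α‖ := by
  refine ⟨1 / 32, by norm_num, fun n m hm hmn V hV hV1 L hL => ?_⟩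
  have hn : 1 ≤ n := hm.trans hmn
  have hM := one_le_levyMean_gauge hn hV hV1
  set M := levyMean n (gauge V)
  have hL' : Module.finrank ℝ Lᗮ = n - m := by
    have := L.finrank_add_finrank_orthogonal
    rw [finrank_euclideanSpace_fin, hL] at this
    omega
  have hnhds := mem_interior_iff_mem_nhds.1 hV.2.2.1
  obtain ⟨α, ⟨hαV, hαL⟩, hmax⟩ := (hV.1.inter_right L.closed_of_finiteDimensional).exists_isMaxOn
    ⟨0, mem_of_mem_nhds hnhds, L.zero_mem⟩ continuous_norm.continuousOn
  have hmax' : ∀ x ∈ V, x ∈ L → ‖x‖ ≤ ‖α‖ := fun x hx hxL => hmax ⟨hx, hxL⟩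
  have hupper := volume_real_le_of_inter_submodule_subset L hV.2.1 hV.1.isClosed hV.2.2.2
    zero_le_one hV1 (norm_nonneg α) hmax'
  have hlower := unitBallVolume_le_volume_real hn hV (by linarith)
  have hprod := unitBallVolume_mul_orthogonal_le L
  rw [hL, hL', one_pow, one_mul] at hupper
  rw [hL, hL', finrank_euclideanSpace_fin] at hprod
  have hK := unitBallVolume_pos n
  have hω := omegaNM_pow hm hmn
  have hW0 := pow_nonneg (omegaNM_nonneg hmn) m
  have hW : omegaNM n m ^ m ≤ √2 ^ n := by
    rw [hω]
    exact (div_le_iff₀ hK).2 hprod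
  have hWK : unitBallVolume m * unitBallVolume (n - m) = omegaNM n m ^ m * unitBallVolume n := by
    rw [hω]
    field_simp
  have hWsq : (omegaNM n m ^ m) * (omegaNM n m ^ m) ≤ 2 ^ n :=
    (mul_le_mul hW hW hW0 (by positivity)).trans_eq (by
      rw [← mul_pow, Real.mul_self_sqrt zero_le_two])
  have h2 : (2 : ℝ) ^ m ≤ 2 ^ n := pow_le_pow_right₀ one_le_two hmn
  have hone : 1 ≤ (8 * M) ^ n * ‖α‖ ^ m * omegaNM n m ^ m := by
    refine le_of_mul_le_mul_right ?_ hK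
    calc 1 * unitBallVolume n ≤ (4 * M) ^ n * volume.real V := by rwa [one_mul]
      _ ≤ (4 * M) ^ n * (2 ^ n * ‖α‖ ^ m * (omegaNM n m ^ m * unitBallVolume n)) := by
        gcongr
        refine hupper.trans ?_
        rw [mul_assoc, hWK, mul_pow]
        gcongr
      _ = (8 * M) ^ n * ‖α‖ ^ m * omegaNM n m ^ m * unitBallVolume n := by
        rw [show 8 * M = 4 * M * 2 by ring, mul_pow _ (2 : ℝ)]
        ring
  have hkey : omegaNM n m ^ m ≤ (16 * M) ^ n * ‖α‖ ^ m := by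
    calc omegaNM n m ^ m ≤ ((8 * M) ^ n * ‖α‖ ^ m * omegaNM n m ^ m) * omegaNM n m ^ m :=
          le_mul_of_one_le_left hW0 hone
      _ = (8 * M) ^ n * ‖α‖ ^ m * (omegaNM n m ^ m * omegaNM n m ^ m) := by ring
      _ ≤ (8 * M) ^ n * ‖α‖ ^ m * 2 ^ n := by gcongr
      _ = (16 * M) ^ n * ‖α‖ ^ m := by
        rw [show 16 * M = 8 * M * 2 by ring, mul_pow _ (2 : ℝ)]
        ring
  refine ⟨α, hαL, ?_, ?_⟩
  · rintro rfl
    rw [norm_zero, zero_pow (by omega)] at hone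
    norm_num at hone
  · have hbase : (0 : ℝ) ≤ 2 * (1 / 32) / M := by positivity
    have hω0 := omegaNM_nonneg hmn
    refine (mul_le_of_le_one_right (by positivity) (gauge_le_one_of_mem hαV)).trans ?_
    refine le_of_pow_le_pow_left₀ (by omega : m ≠ 0) (norm_nonneg α) ?_
    rw [mul_pow, ← Real.rpow_mul_natCast hbase, div_mul_cancel₀ _ (by positivity),
      Real.rpow_natCast, show 2 * (1 / 32) / M = (16 * M)⁻¹ by field_simp; norm_num, inv_pow,
      inv_mul_le_iff₀ (by positivity)]
    exact hkey
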